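/- Let M be an unmixed finitely generated module of dimension d over a local ring A (quotient of a Gorenstein local ring), not satisfying S_2, with depth M = d − 1. Then dim D^{d-1}(M) = d − 2, and depth D^{d-1}(M) = depth K_M − 2. In particular D^{d-1}(M) is Cohen–Macaulay if and only if K_M is Cohen–Macaulay. -/

import Mathlib

open CategoryTheory

noncomputable section

/-- The dimension of a module: Krull dimension of its support. -/
def moduleDim (R : Type) [CommRing R] (M : Type) [AddCommGroup M] [Module R M] :
    WithBot (WithTop ℕ) :=
  Order.krullDim (Module.support R M)

/-- The depth of a module over a local ring: supremum of lengths of regular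
sequences on `M` contained in the maximal ideal. -/
def moduleDepth (R : Type) [CommRing R] [IsLocalRing R] (M : Type) [AddCommGroup M]
    [Module R M] : ℕ∞ :=
  sSup {n : ℕ∞ | ∃ rs : List R, (rs.length : ℕ∞) = n ∧
    (∀ r ∈ rs, r ∈ IsLocalRing.maximalIdeal R) ∧ RingTheory.Sequence.IsRegular M rs}

/-- A module over a local ring is Cohen–Macaulay if it is zero or its depth
equals its (Krull) dimension. -/
def IsCM (R : Type) [CommRing R] [IsLocalRing R] (M : Type) [AddCommGroup M]
    [Module R M] : Prop :=
  Subsingleton M ∨ moduleDim R M = (moduleDepth R M : WithBot ℕ∞)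

/-- `extModule R n M N` is `Ext_R^n(M, N)` as an `R`-module object. -/
def extModule (R : Type) [CommRing R] (n : ℕ) (M N : Type) [AddCommGroup M] [Module R M]
    [AddCommGroup N] [Module R N] : ModuleCat R :=
  ((Ext R (ModuleCat R) n).obj (Opposite.op (ModuleCat.of R M))).obj (ModuleCat.of R N)

/-- A Noetherian local ring `R` of dimension `n` is Gorenstein if
`Ext^i(k, R)` vanishes for `i ≠ n` and is isomorphic to the residue field `k` for `i = n`. -/
def IsGorensteinLocalRing (R : Type) [CommRing R] [IsLocalRing R] : Prop :=
  IsNoetherianRing R ∧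
  ∀ n : ℕ, ringKrullDim R = n →
    (∀ i : ℕ, i ≠ n → Subsingleton ↥(extModule R i (IsLocalRing.ResidueField R) R)) ∧
    Nonempty (extModule R n (IsLocalRing.ResidueField R) R ≅
      ModuleCat.of R (IsLocalRing.ResidueField R))

/-- Serre's condition `S_k` (here `k = 2`): `depth M_P ≥ min(2, dim M_P)` for all primes. -/
def SerreS2 (R : Type) [CommRing R] (M : Type) [AddCommGroup M] [Module R M] : Prop :=
  ∀ (P : Ideal R) [P.IsPrime],
    min 2 (moduleDim (Localization.AtPrime P) (LocalizedModule P.primeCompl M)) ≤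
      ((moduleDepth (Localization.AtPrime P) (LocalizedModule P.primeCompl M) : ℕ∞) :
        WithBot ℕ∞)

/-- A module is unmixed if all its associated primes have the same dimension, `dim M`. -/
def IsUnmixed (A : Type) [CommRing A] (M : Type) [AddCommGroup M] [Module A M] : Prop :=
  ∀ P ∈ associatedPrimes A M, ringKrullDim (A ⧸ P) = moduleDim A M

section helpers
open scoped Pointwise
set_option linter.unusedSectionVars false

abbrev EE (R : Type) [CommRing R] (i : ℕ) (X : Type) [AddCommGroup X] [Module R X] : Type :=
  Abelian.Ext (ModuleCat.of R X) (ModuleCat.of R R) i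

section cmp
variable {R : Type} [CommRing R]

lemma extMk_smul {X Y : ModuleCat.{0} R} (P : ProjectiveResolution X) {n : ℕ}
    (f : P.complex.X n ⟶ Y) (m : ℕ) (hm : n + 1 = m)
    (hf : P.complex.d m n ≫ f = 0) (r : R) :
    r • P.extMk f m hm hf = P.extMk (r • f) m hm (by simp [hf]) := by
  rw [Abelian.Ext.smul_eq_comp_mk₀, ProjectiveResolution.extMk_comp_mk₀]
  simp

def cocycMap {X Y : ModuleCat.{0} R} (P : ProjectiveResolution X) (n : ℕ) :
    LinearMap.ker ((Linear.leftComp R Y (P.complex.d (n+1) n))) →ₗ[R] Abelian.Ext X Y n where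
  toFun f := P.extMk f.1 (n+1) rfl f.2
  map_add' _ _ := (P.add_extMk _ _ _ _ _ _).symm
  map_smul' _ _ := (extMk_smul P _ _ _ _ _).symm

lemma sc_homology_equiv (S : ShortComplex (ModuleCat.{0} R)) (E : Type) [AddCommGroup E]
    [Module R E]
    (φ : LinearMap.ker S.g.hom →ₗ[R] E) (hs : Function.Surjective φ)
    (hk : ∀ z, φ z = 0 ↔ ∃ y : S.X₁, S.f.hom y = z.1) :
    Nonempty (S.homology ≃ₗ[R] E) := by
  have e1 : S.homology ≃ₗ[R] S.moduleCatLeftHomologyData.H := S.moduleCatHomologyIso.toLinearEquiv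
  have e2 : (LinearMap.ker S.g.hom ⧸ LinearMap.range S.moduleCatToCycles) ≃ₗ[R] E :=
    (Submodule.quotEquivOfEq _ _ (by
      ext z
      rw [LinearMap.mem_ker, hk]
      constructor
      · rintro ⟨y, rfl⟩; exact ⟨y, rfl⟩
      · rintro ⟨y, hy⟩; exact ⟨y, Subtype.ext hy⟩)).trans (φ.quotKerEquivOfSurjective hs)
  exact ⟨e1.trans e2⟩

lemma homology_equiv_succ {X Y : ModuleCat.{0} R} (P : ProjectiveResolution X) (n : ℕ) :
    Nonempty ((P.complex.linearYonedaObj R Y).homology (n+1) ≃ₗ[R] Abelian.Ext X Y (n+1)) := by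
  have e1 := ((P.complex.linearYonedaObj R Y).homologyIsoSc' n (n+1) (n+2) (by simp)
    (by simp)).toLinearEquiv
  have h2 := sc_homology_equiv ((P.complex.linearYonedaObj R Y).sc' n (n+1) (n+2))
    (Abelian.Ext X Y (n+1)) (cocycMap P (n+1)) (by
      intro a
      obtain ⟨f, hf, h⟩ := P.extMk_surjective a (n+2) rfl
      exact ⟨⟨f, hf⟩, h⟩) (by
      intro z
      exact P.extMk_eq_zero_iff z.1 (n+2) rfl z.2 n rfl)
  exact ⟨e1.trans h2.some⟩

lemma homology_equiv_zero {X Y : ModuleCat.{0} R} (P : ProjectiveResolution X) :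
    Nonempty ((P.complex.linearYonedaObj R Y).homology 0 ≃ₗ[R] Abelian.Ext X Y 0) := by
  have e1 := ((P.complex.linearYonedaObj R Y).homologyIsoSc' 0 0 1 (by simp)
    (by simp)).toLinearEquiv
  let π : P.complex.X 0 ⟶ X := P.π.f 0
  have hπ : Epi π := inferInstanceAs (Epi (P.π.f 0))
  have hdπ : P.complex.d 1 0 ≫ π = 0 := P.complex_d_comp_π_f_zero
  have hex : (ShortComplex.mk (P.complex.d 1 0) π hdπ).Exact := P.exact₀
  let ψ : (X ⟶ Y) →ₗ[R] LinearMap.ker ((P.complex.linearYonedaObj R Y).sc' 0 0 1).g.hom :=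
    LinearMap.codRestrict _ (Linear.leftComp R Y π) (by
      intro f
      change P.complex.d 1 0 ≫ π ≫ f = 0
      rw [reassoc_of% hdπ, Limits.zero_comp])
  have hb : Function.Bijective ψ := by
    constructor
    · intro f g h
      have : π ≫ f = π ≫ g := congrArg Subtype.val h
      exact (cancel_epi π).1 this
    · rintro ⟨z, hz⟩
      refine ⟨hex.desc z hz, Subtype.ext ?_⟩
      exact hex.g_desc z hz
  let e := LinearEquiv.ofBijective ψ hb
  have h2 := sc_homology_equiv ((P.complex.linearYonedaObj R Y).sc' 0 0 1)
    (X ⟶ Y) e.symm.toLinearMap e.symm.surjective (by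
      intro z
      constructor
      · intro h
        have : z = 0 := e.symm.injective (by simpa using h)
        exact ⟨0, by rw [this]; simp⟩
      · rintro ⟨y, hy⟩
        have h0 : z.1 = 0 := by
          rw [← hy]
          change P.complex.d 0 0 ≫ y = 0
          rw [P.complex.shape 0 0 (by simp)]
          exact Limits.zero_comp
        have : z = 0 := Subtype.ext h0
        rw [this]; simp)
  exact ⟨e1.trans (h2.some.trans Abelian.Ext.linearEquiv₀.symm)⟩

lemma extModule_equiv (i : ℕ) (X : Type) [AddCommGroup X] [Module R X] :
    Nonempty (extModule R i X R ≃ₗ[R] EE R i X) := by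
  obtain ⟨P⟩ : Nonempty (ProjectiveResolution (ModuleCat.of R X)) :=
    ⟨projectiveResolution _⟩
  have e1 := (P.isoExt (R := R) i (ModuleCat.of R R)).toLinearEquiv
  cases i with
  | zero => exact ⟨e1.trans (homology_equiv_zero P).some⟩
  | succ i => exact ⟨e1.trans (homology_equiv_succ P i).some⟩

end cmp

section les
variable {R : Type} [CommRing R]
variable {X Y Z : Type} [AddCommGroup X] [Module R X] [AddCommGroup Y] [Module R Y]
  [AddCommGroup Z] [Module R Z]

def pre (i : ℕ) (f : X →ₗ[R] Y) : EE R i Y →ₗ[R] EE R i X :=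
  (Abelian.Ext.mk₀ (ModuleCat.ofHom f)).precompOfLinear R _ (zero_add i)

lemma pre_apply (i : ℕ) (f : X →ₗ[R] Y) (a : EE R i Y) :
    pre i f a = (Abelian.Ext.mk₀ (ModuleCat.ofHom f)).comp a (zero_add i) := rfl

lemma pre_comp (i : ℕ) (f : X →ₗ[R] Y) (g : Y →ₗ[R] Z) (a : EE R i Z) :
    pre i (g ∘ₗ f) a = pre i f (pre i g a) := by
  simp only [pre_apply]
  rw [ModuleCat.ofHom_comp, Abelian.Ext.mk₀_comp_mk₀_assoc]

lemma pre_smul_id (i : ℕ) (x : R) (a : EE R i X) :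
    pre i (x • (LinearMap.id : X →ₗ[R] X)) a = x • a := by
  rw [pre_apply]
  have : ModuleCat.ofHom (x • (LinearMap.id : X →ₗ[R] X)) = x • 𝟙 (ModuleCat.of R X) := rfl
  rw [this, Abelian.Ext.mk₀_smul, Abelian.Ext.smul_comp, Abelian.Ext.mk₀_id_comp]

lemma pre_id (i : ℕ) (a : EE R i X) : pre i (LinearMap.id : X →ₗ[R] X) a = a := by
  have := pre_smul_id i (1 : R) a
  simpa using this

def EEcongr (i : ℕ) (e : X ≃ₗ[R] Y) : EE R i Y ≃ₗ[R] EE R i X :=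
  LinearEquiv.ofLinearMap (pre i e.toLinearMap) (pre i e.symm.toLinearMap)
    (by ext a; simp [← pre_comp, pre_id]) (by ext a; simp [← pre_comp, pre_id])

lemma les (f : X →ₗ[R] Y) (g : Y →ₗ[R] Z) (hf : Function.Injective f)
    (hg : Function.Surjective g) (h : Function.Exact f g) :
    ∃ δ : ∀ i, EE R i X →ₗ[R] EE R (i+1) Z,
      (∀ i, Function.Exact (pre i g) (pre i f)) ∧
      (∀ i, Function.Exact (pre i f) (δ i)) ∧
      (∀ i, Function.Exact (δ i) (pre (i+1) g)) ∧ Function.Injective (pre 0 g) := by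
  let S : ShortComplex (ModuleCat.{0} R) := ShortComplex.mk (ModuleCat.ofHom f) (ModuleCat.ofHom g)
    (by ext x; exact h.apply_apply_eq_zero x)
  have hS : S.ShortExact :=
    { exact := (ShortComplex.ShortExact.moduleCat_exact_iff_function_exact S).2 h
      mono_f := (ModuleCat.mono_iff_injective _).2 hf
      epi_g := (ModuleCat.epi_iff_surjective _).2 hg }
  refine ⟨fun i => hS.extClass.precompOfLinear R (ModuleCat.of R R) (add_comm 1 i), ?_, ?_, ?_, ?_⟩
  · intro i a
    constructor
    · intro ha
      exact Abelian.Ext.contravariant_sequence_exact₂ hS _ a ha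
    · rintro ⟨b, rfl⟩
      rw [← pre_comp, h.linearMap_comp_eq_zero]
      simp [pre_apply]
  · intro i a
    constructor
    · intro ha
      exact Abelian.Ext.contravariant_sequence_exact₁ hS _ a (add_comm 1 i) ha
    · rintro ⟨b, rfl⟩
      exact hS.extClass_comp_assoc b (h := add_comm 1 i)
  · intro i a
    constructor
    · intro ha
      exact Abelian.Ext.contravariant_sequence_exact₃ hS _ a ha (add_comm 1 i)
    · rintro ⟨b, rfl⟩
      exact hS.comp_extClass_assoc b (h := add_comm 1 i)
  · exact Abelian.Ext.precomp_mk₀_injective_of_epi (hg := hS.epi_g) _ _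

lemma EE_proj [Module.Projective R X] (i : ℕ) : Subsingleton (EE R (i+1) X) := by
  have : Projective (ModuleCat.of R X) := ModuleCat.projective_of_categoryTheory_projective _
  exact ⟨fun a b => by rw [a.eq_zero_of_projective, b.eq_zero_of_projective]⟩

def EEzero : EE R 0 X ≃ₗ[R] (X →ₗ[R] R) :=
  Abelian.Ext.linearEquiv₀.trans ModuleCat.homLinearEquiv

instance [IsNoetherianRing R] [Module.Finite R X] (i : ℕ) : Module.Finite R (EE R i X) :=
  ModuleCat.finite_ext R _ _ i
end les

section supp
variable {R : Type} [CommRing R]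
variable {X Y Z : Type} [AddCommGroup X] [Module R X] [AddCommGroup Y] [Module R Y]
  [AddCommGroup Z] [Module R Z]

/-- `NS p X`: the localization of `X` at `p` vanishes. -/
abbrev NS (p : PrimeSpectrum R) (X : Type) [AddCommGroup X] [Module R X] : Prop :=
  p ∉ Module.support R X

lemma NS_exact {f : X →ₗ[R] Y} {g : Y →ₗ[R] Z} (h : Function.Exact f g) (p : PrimeSpectrum R)
    (hX : NS p X) (hZ : NS p Z) : NS p Y := by
  rw [NS, Module.notMem_support_iff'] at *
  intro y
  obtain ⟨r, hr, h1⟩ := hZ (g y)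
  rw [← map_smul] at h1
  obtain ⟨x, hx⟩ := (h _).1 h1
  obtain ⟨s, hs, h2⟩ := hX x
  refine ⟨s * r, p.asIdeal.primeCompl.mul_mem hs hr, ?_⟩
  rw [mul_smul, ← hx, ← map_smul, h2, map_zero]

lemma NS_of_subsingleton (p : PrimeSpectrum R) [Subsingleton X] : NS p X := by
  rw [NS, Module.support_eq_empty]; simp

lemma NS_congr (e : X ≃ₗ[R] Y) (p : PrimeSpectrum R) : NS p X ↔ NS p Y := by
  rw [NS, NS, e.support_eq]

lemma NS_EE (p : PrimeSpectrum R) [Module.Finite R X] (h : NS p X) (i : ℕ) : NS p (EE R i X) := by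
  rw [NS, Module.mem_support_iff_of_finite, SetLike.not_le_iff_exists] at h
  obtain ⟨r, hr, hrp⟩ := h
  rw [NS, Module.notMem_support_iff']
  intro a
  refine ⟨r, hrp, ?_⟩
  rw [← pre_smul_id]
  have : r • (LinearMap.id : X →ₗ[R] X) = 0 := by
    ext x; exact Module.mem_annihilator.1 hr x
  rw [this]; simp [pre_apply]

variable (f : X →ₗ[R] Y) (g : Y →ₗ[R] Z) (hf : Function.Injective f)
    (hg : Function.Surjective g) (h : Function.Exact f g) (p : PrimeSpectrum R) (i : ℕ)
include hf hg h

lemma L1 (h1 : NS p (EE R i Z)) (h2 : NS p (EE R i X)) : NS p (EE R i Y) := by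
  obtain ⟨δ, e1, e2, e3, -⟩ := les f g hf hg h
  exact NS_exact (e1 i) p h1 h2

lemma L2 (h1 : NS p (EE R i X)) (h2 : NS p (EE R (i+1) Y)) : NS p (EE R (i+1) Z) := by
  obtain ⟨δ, e1, e2, e3, -⟩ := les f g hf hg h
  exact NS_exact (e3 i) p h1 h2

lemma L3 (h1 : NS p (EE R i Y)) (h2 : NS p (EE R (i+1) Z)) : NS p (EE R i X) := by
  obtain ⟨δ, e1, e2, e3, -⟩ := les f g hf hg h
  exact NS_exact (e2 i) p h1 h2

lemma L0 (h1 : NS p (EE R 0 Y)) : NS p (EE R 0 Z) := by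
  obtain ⟨δ, e1, e2, e3, e4⟩ := les f g hf hg h
  exact fun h' => h1 (Module.support_subset_of_injective _ e4 h')
omit hf hg h

lemma smul_exact (x : R) : Function.Exact (x • (LinearMap.id : X →ₗ[R] X))
    (Submodule.mkQ (x • (⊤ : Submodule R X))) := by
  intro y
  simp only [Submodule.mkQ_apply, Submodule.Quotient.mk_eq_zero, Submodule.mem_smul_pointwise_iff_exists]
  simp

lemma L4 [IsNoetherianRing R] [Module.Finite R X] (x : R) (hx : IsSMulRegular X x)
    (hp : x ∈ p.asIdeal) (h : NS p (EE R (i+1) (QuotSMulTop x X))) : NS p (EE R i X) := by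
  obtain ⟨δ, e1, e2, e3, -⟩ := les (x • (LinearMap.id : X →ₗ[R] X))
    (Submodule.mkQ (x • (⊤ : Submodule R X))) hx (Submodule.mkQ_surjective _) (smul_exact x)
  intro hs
  have hq : p ∈ Module.support R (QuotSMulTop x (EE R i X)) := by
    rw [Module.support_quotSMulTop]
    exact ⟨hs, by simpa using hp⟩
  have key : ∀ a ∈ x • (⊤ : Submodule R (EE R i X)), δ i a = 0 := by
    intro a ha
    rw [Submodule.mem_smul_pointwise_iff_exists] at ha
    obtain ⟨b, -, rfl⟩ := ha
    rw [e2 i]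
    exact ⟨b, pre_smul_id i x b⟩
  let ψ : QuotSMulTop x (EE R i X) →ₗ[R] EE R (i+1) (QuotSMulTop x X) :=
    Submodule.liftQ _ (δ i) key
  have hψ : Function.Injective ψ := by
    rw [← LinearMap.ker_eq_bot, LinearMap.ker_eq_bot']
    intro a
    obtain ⟨a, rfl⟩ := Submodule.mkQ_surjective _ a
    intro ha
    have ha' : δ i a = 0 := ha
    obtain ⟨b, hb⟩ := (e2 i a).1 ha'
    rw [pre_smul_id] at hb
    rw [Submodule.mkQ_apply, Submodule.Quotient.mk_eq_zero, Submodule.mem_smul_pointwise_iff_exists]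
    exact ⟨b, trivial, hb⟩
  exact h (Module.support_subset_of_injective ψ hψ hq)

end supp

section prelim
variable {R : Type} [CommRing R] [IsNoetherianRing R]
variable {X Y Z : Type} [AddCommGroup X] [Module R X] [AddCommGroup Y] [Module R Y]
  [AddCommGroup Z] [Module R Z]

lemma mem_supp_quot (p q : PrimeSpectrum R) : p ∈ Module.support R (R ⧸ q.asIdeal) ↔ q ≤ p := by
  rw [Module.mem_support_iff_of_finite, Ideal.annihilator_quotient]
  rfl

/-- prime filtration principle -/
lemma PF [Module.Finite R X] (p : PrimeSpectrum R) (i : ℕ)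
    (H : ∀ q ∈ Module.support R X, q ≤ p → NS p (EE R i (R ⧸ q.asIdeal))) : NS p (EE R i X) := by
  revert H
  refine IsNoetherianRing.induction_on_isQuotientEquivQuotientPrime R (M := X) inferInstance
    (motive := fun N _ _ _ => (∀ q ∈ Module.support R N, q ≤ p → NS p (EE R i (R ⧸ q.asIdeal))) →
      NS p (EE R i N)) ?_ ?_ ?_
  · intro N _ _ _ _ _
    exact NS_EE p (NS_of_subsingleton p) i
  · intro N _ _ _ q e H
    rw [← NS_congr (EEcongr i e)]
    by_cases hq : q ≤ p
    · apply H q _ hq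
      rw [e.support_eq, mem_supp_quot]
    · apply NS_EE
      rwa [NS, mem_supp_quot]
  · intro N₁ _ _ _ N₂ _ _ _ N₃ _ _ _ f g hf hg h H1 H3 H
    refine L1 f g hf hg h p i (H3 fun q hq => H q ?_) (H1 fun q hq => H q ?_)
    · exact Module.support_subset_of_surjective g hg hq
    · exact Module.support_subset_of_injective f hf hq

lemma reg_quot (q : PrimeSpectrum R) {x : R} (hx : x ∉ q.asIdeal) :
    IsSMulRegular (R ⧸ q.asIdeal) x := by
  rw [isSMulRegular_iff_right_eq_zero_of_smul]
  intro a ha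
  obtain ⟨a, rfl⟩ := Ideal.Quotient.mk_surjective a
  rw [← Ideal.Quotient.mk_eq_mk, ← Submodule.Quotient.mk_smul] at ha
  have ha := (Submodule.Quotient.mk_eq_zero _).1 ha
  rw [Ideal.Quotient.eq_zero_iff_mem]
  exact (q.2.mem_or_mem ha).resolve_left hx

lemma step (p q : PrimeSpectrum R) (i : ℕ) (hqp : q < p)
    (H : ∀ q', q < q' → q' ≤ p → NS p (EE R (i+1) (R ⧸ q'.asIdeal))) :
    NS p (EE R i (R ⧸ q.asIdeal)) := by
  obtain ⟨x, hx, hxq⟩ := SetLike.exists_of_lt (show q.asIdeal < p.asIdeal from hqp)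
  refine L4 p i x (reg_quot q hxq) hx (PF p (i+1) fun q' hq' hqp' => H q' ?_ hqp')
  rw [Module.support_quotSMulTop] at hq'
  have h1 := (mem_supp_quot _ _).1 hq'.1
  refine lt_of_le_of_ne h1 ?_
  rintro rfl
  exact hxq (by simpa using hq'.2)

lemma bass (p q : PrimeSpectrum R) (i : ℕ) (hpq : p ⋖ q)
    (h : p ∈ Module.support R (EE R i (R ⧸ p.asIdeal))) :
    q ∈ Module.support R (EE R (i+1) (R ⧸ q.asIdeal)) := by
  by_contra hc
  have := step q p i hpq.1 (fun q' h1 h2 => by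
    rcases h2.eq_or_lt with rfl | h2
    · exact hc
    · exact absurd h2 (hpq.2 h1))
  exact this (Module.mem_support_mono hpq.1.le h)

/-- `R/p` embeds for associated `p`. -/
lemma ass_emb {p : Ideal R} (hp : p ∈ associatedPrimes R X) :
    ∃ f : (R ⧸ p) →ₗ[R] X, Function.Injective f := by
  exact ((isAssociatedPrime_iff_exists_injective_linearMap _ _).1 hp).2

instance wfgt : WellFoundedGT (PrimeSpectrum R) :=
  StrictMono.wellFoundedGT (f := fun p : PrimeSpectrum R => p.asIdeal) (fun _ _ h => h)

lemma ht [IsLocalRing R] (p : PrimeSpectrum R) : Order.height p < ⊤ := by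
  have := (inferInstance : FiniteDimensionalOrder (PrimeSpectrum R))
  rw [← WithBot.coe_lt_coe]
  apply lt_of_le_of_lt (Order.height_le_krullDim p)
  simpa using Order.krullDim_ne_top_of_finiteDimensionalOrder.lt_top
instance wflt [IsLocalRing R] : WellFoundedLT (PrimeSpectrum R) :=
  StrictMono.wellFoundedLT (f := fun p : PrimeSpectrum R => (Order.height p).toNat) (fun p q h => by
    have hf := ht p
    have hf' := ht q
    have := Order.height_strictMono h hf
    rw [← ENat.natCast_toNat hf.ne, ← ENat.natCast_toNat hf'.ne] at this
    exact_mod_cast this)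

lemma gg2 [IsLocalRing R] (p : PrimeSpectrum R) : ∃ i, p ∈ Module.support R (EE R i (R ⧸ p.asIdeal)) := by
  induction p using WellFoundedLT.induction with
  | ind p ih =>
  by_cases hm : IsMin p
  · have h1 : p.asIdeal ∈ associatedPrimes R R := by
      apply Module.associatedPrimes.minimalPrimes_annihilator_subset_associatedPrimes
      rw [Module.annihilator_eq_bot.2 inferInstance]
      exact (PrimeSpectrum.isMin_iff).1 hm
    obtain ⟨f, hf⟩ := ass_emb h1
    refine ⟨0, ?_⟩
    rw [EEzero.support_eq]
    by_contra hc
    rw [Module.notMem_support_iff'] at hc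
    obtain ⟨s, hs, h⟩ := hc f
    have h2 := LinearMap.congr_fun h (Ideal.Quotient.mk _ 1)
    rw [LinearMap.smul_apply, ← map_smul, LinearMap.zero_apply] at h2
    have h3 := hf (h2.trans (map_zero f).symm)
    rw [← Ideal.Quotient.mk_eq_mk, ← Submodule.Quotient.mk_smul,
      Submodule.Quotient.mk_eq_zero] at h3
    simp at h3
    exact hs h3
  · have : ∃ q, q ⋖ p := exists_covBy_of_wellFoundedGT hm
    obtain ⟨q, hq⟩ := this
    obtain ⟨i, hi⟩ := ih q hq.1
    exact ⟨i+1, bass q p i hq hi⟩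
end prelim

section dq
variable {R : Type} [CommRing R] [IsNoetherianRing R] [IsLocalRing R]
variable {X Y Z : Type} [AddCommGroup X] [Module R X] [AddCommGroup Y] [Module R Y]
  [AddCommGroup Z] [Module R Z]

/-- dimension of `R/p` -/
def dq (p : PrimeSpectrum R) : ℕ := (Order.coheight p).toNat

lemma dq_coe (p : PrimeSpectrum R) : (dq p : ℕ∞) = Order.coheight p :=
  ENat.natCast_toNat (Order.coheight_lt_top p).ne

lemma dq_anti {p q : PrimeSpectrum R} (h : p < q) : dq q < dq p := by
  have := Order.coheight_strictAnti h (Order.coheight_lt_top q)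
  rw [← dq_coe, ← dq_coe] at this
  exact_mod_cast this

lemma dq_anti' {p q : PrimeSpectrum R} (h : p ≤ q) : dq q ≤ dq p := by
  rcases h.eq_or_lt with rfl | h
  · rfl
  · exact (dq_anti h).le

abbrev mm (R : Type) [CommRing R] [IsLocalRing R] : PrimeSpectrum R := IsLocalRing.closedPoint R

lemma le_mm (p : PrimeSpectrum R) : p ≤ mm R := IsLocalRing.le_maximalIdeal p.2.ne_top

lemma dq_mm : dq (mm R) = 0 := by
  have : Order.coheight (mm R) = 0 := by
    rw [Order.coheight_eq_zero]
    intro q _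
    exact le_mm q
  rw [dq, this]; rfl

lemma exists_cov (p : PrimeSpectrum R) (h : p ≠ mm R) : ∃ q, p ⋖ q ∧ dq q + 1 = dq p := by
  have h0 : dq p ≠ 0 := by
    have := dq_anti (lt_of_le_of_ne (le_mm p) h)
    omega
  obtain ⟨k, hk⟩ := Nat.exists_eq_succ_of_ne_zero h0
  have h1 : Order.coheight p = (k : ℕ∞) + 1 := by
    rw [← dq_coe, hk]; push_cast; rfl
  rw [Order.coheight_eq_coe_add_one_iff] at h1
  obtain ⟨-, ⟨q, hq, hqk⟩, -⟩ := h1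
  have h2 : dq q = k := by
    rw [dq, hqk]; rfl
  refine ⟨q, ⟨hq, fun r hr1 hr2 => ?_⟩, by omega⟩
  have := dq_anti hr1
  have := dq_anti hr2
  omega

lemma ringKrullDim_dq (p : PrimeSpectrum R) : ringKrullDim (R ⧸ p.asIdeal) = dq p := by
  have h : PrimeSpectrum.zeroLocus (p.asIdeal : Set R) = Set.Ici p := by
    ext q; rfl
  rw [ringKrullDim_quotient, h, ← Order.coheight_eq_krullDim_Ici, ← dq_coe]
  rfl

variable {n : ℕ} (hG : ∀ i, i ≠ n → Subsingleton (EE R i (R ⧸ IsLocalRing.maximalIdeal R)))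
include hG

lemma gg1 (p : PrimeSpectrum R) (i : ℕ) (h : p ∈ Module.support R (EE R i (R ⧸ p.asIdeal))) :
    i + dq p = n := by
  induction hk : dq p generalizing p i with
  | zero =>
    have hp : p = mm R := by
      by_contra hc
      obtain ⟨q, -, h2⟩ := exists_cov p hc
      omega
    subst hp
    by_contra hc
    have := hG i hc
    exact NS_of_subsingleton (X := EE R i (R ⧸ IsLocalRing.maximalIdeal R)) _ h
  | succ k ih =>
    have hp : p ≠ mm R := by
      rintro rfl
      rw [dq_mm] at hk; omega
    obtain ⟨q, h1, h2⟩ := exists_cov p hp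
    have := ih q (i+1) (bass p q i h1 h) (by omega)
    omega

lemma gg3 (p : PrimeSpectrum R) : dq p ≤ n ∧
    p ∈ Module.support R (EE R (n - dq p) (R ⧸ p.asIdeal)) := by
  obtain ⟨i, hi⟩ := gg2 p
  have := gg1 hG p i hi
  have h2 : n - dq p = i := by omega
  rw [h2]
  exact ⟨by omega, hi⟩

lemma F2' (q : PrimeSpectrum R) (i : ℕ) (h : i + dq q < n) : NS (mm R) (EE R i (R ⧸ q.asIdeal)) := by
  induction hk : dq q using Nat.strong_induction_on generalizing q i with
  | _ k ih =>
  by_cases hq : q = mm R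
  · subst hq
    have := hG i (by omega)
    exact NS_of_subsingleton (X := EE R i (R ⧸ IsLocalRing.maximalIdeal R)) _
  · refine step _ q i (lt_of_le_of_ne (le_mm q) hq) fun q' h1 h2 => ?_
    have := dq_anti h1
    exact ih (dq q') (by omega) q' (i+1) (by omega) rfl

lemma F1' (p q : PrimeSpectrum R) (i : ℕ) (hqp : q ≤ p) (h : n < i + dq p) :
    NS p (EE R i (R ⧸ q.asIdeal)) := by
  induction hk : dq q using Nat.strong_induction_on generalizing q i with
  | _ k ih =>
  rcases hqp.eq_or_lt with rfl | hlt
  · intro hc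
    have := gg1 hG q i hc
    omega
  · refine step _ q i hlt fun q' h1 h2 => ?_
    have := dq_anti h1
    exact ih (dq q') (by omega) q' (i+1) h2 (by omega) rfl

lemma F1 [Module.Finite R X] (p : PrimeSpectrum R) (i : ℕ) (h : n < i + dq p) :
    NS p (EE R i X) := PF p i fun q _ hqp => F1' hG p q i hqp h

omit hG in
lemma sub_of_NS (R : Type) [CommRing R] [IsNoetherianRing R] [IsLocalRing R] {X : Type} [AddCommGroup X] [Module R X] (h : NS (mm R) X) : Subsingleton X := by
  rw [← Module.support_eq_empty_iff (R := R)]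
  by_contra hc
  obtain ⟨p, hp⟩ := Set.nonempty_iff_ne_empty.2 hc
  exact h (Module.mem_support_mono (le_mm p) hp)

lemma F2 [Module.Finite R X] (i c : ℕ) (hc : ∀ q ∈ Module.support R X, dq q ≤ c) (h : i + c < n) :
    Subsingleton (EE R i X) := by
  apply sub_of_NS R
  refine PF _ i fun q hq _ => F2' hG q i ?_
  have := hc q hq
  omega

lemma F1m [Module.Finite R X] (i : ℕ) (h : n < i) : Subsingleton (EE R i X) := by
  apply sub_of_NS R
  apply F1 hG
  rw [dq_mm]; omega

lemma assSupp [Module.Finite R X] (p : PrimeSpectrum R) (hp : p.asIdeal ∈ associatedPrimes R X) :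
    p ∈ Module.support R (EE R (n - dq p) X) := by
  obtain ⟨f, hf⟩ := ass_emb hp
  obtain ⟨h1, h2⟩ := gg3 hG p
  by_contra hc
  refine L3 f (Submodule.mkQ (LinearMap.range f)) hf (Submodule.mkQ_surjective _)
    (LinearMap.exact_map_mkQ_range f) p (n - dq p) hc ?_ h2
  apply F1 hG
  omega
end dq

section reg
variable {R : Type} [CommRing R]
variable {X : Type} [AddCommGroup X] [Module R X]

def HasReg (R : Type) [CommRing R] [IsLocalRing R] (t : ℕ) (X : Type) [AddCommGroup X] [Module R X] : Prop :=
  ∃ rs : List R, rs.length = t ∧ (∀ r ∈ rs, r ∈ IsLocalRing.maximalIdeal R) ∧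
    RingTheory.Sequence.IsRegular X rs

lemma depth_exists [IsLocalRing R] [Nontrivial X] (t : ℕ) (h : (t : ℕ∞) ≤ moduleDepth R X) :
    ∃ s, t ≤ s ∧ HasReg R s X := by
  cases t with
  | zero => exact ⟨0, le_rfl, [], rfl, by simp, RingTheory.Sequence.IsRegular.nil R X⟩
  | succ k =>
    have h1 : (k : ℕ∞) < moduleDepth R X := lt_of_lt_of_le (by exact_mod_cast Nat.lt_succ_self k) h
    rw [moduleDepth, lt_sSup_iff] at h1
    obtain ⟨a, ⟨rs, rfl, h2, h3⟩, h4⟩ := h1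
    exact ⟨rs.length, by exact_mod_cast h4, rs, rfl, h2, h3⟩

lemma depth_ge [IsLocalRing R] (t : ℕ) (h : HasReg R t X) : (t : ℕ∞) ≤ moduleDepth R X := by
  obtain ⟨rs, h1, h2, h3⟩ := h
  exact le_sSup ⟨rs, by rw [h1], h2, h3⟩

lemma exists_reg [IsNoetherianRing R] [Module.Finite R X] (p : Ideal R)
    (H : ∀ q ∈ associatedPrimes R X, ¬ p ≤ q) : ∃ x ∈ p, IsSMulRegular X x := by
  by_contra hc
  push Not at hc
  have h1 : (p : Set R) ⊆ ⋃ q ∈ associatedPrimes R X, (q : Set R) := by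
    rw [biUnion_associatedPrimes_eq_compl_regular]
    intro x hx
    exact hc x hx
  have hfin := associatedPrimes.finite R X
  rw [Ideal.subset_union_prime_finite hfin (f := fun q => q) p p
    (fun q hq _ _ => IsAssociatedPrime.isPrime hq)] at h1
  obtain ⟨q, hq, hle⟩ := h1
  exact H q hq hle
end reg

section dep
variable {R : Type} [CommRing R] [IsNoetherianRing R] [IsLocalRing R]
variable {n : ℕ} (hG : ∀ i, i ≠ n → Subsingleton (EE R i (R ⧸ IsLocalRing.maximalIdeal R)))
include hG

lemma F3 (t : ℕ) (X : Type) [AddCommGroup X] [Module R X] [Module.Finite R X] [Nontrivial X] :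
    HasReg R t X ↔ ∀ i, n < i + t → Subsingleton (EE R i X) := by
  induction t generalizing X with
  | zero =>
    constructor
    · intro _ i hi
      exact F1m hG i hi
    · intro _
      exact ⟨[], rfl, by simp, RingTheory.Sequence.IsRegular.nil R X⟩
  | succ t ih =>
    have hnt : ∀ x ∈ IsLocalRing.maximalIdeal R, Nontrivial (QuotSMulTop x X) := by
      intro x hx
      rw [← Module.nonempty_support_iff (R := R), Module.support_quotSMulTop]
      refine ⟨mm R, ?_, by rw [PrimeSpectrum.mem_zeroLocus, Set.singleton_subset_iff]; exact hx⟩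
      obtain ⟨p, hp⟩ := (Module.nonempty_support_iff (R := R) (M := X)).2 inferInstance
      exact Module.mem_support_mono (le_mm p) hp
    constructor
    · rintro ⟨rs, h1, h2, h3⟩ i hi
      match rs, h1, h2, h3 with
      | [], h1, _, _ => simp at h1
      | x :: rs, h1, h2, h3 =>
        rw [RingTheory.Sequence.isRegular_cons_iff] at h3
        have hx := h2 x (by simp)
        have := hnt x hx
        have h4 := (ih (QuotSMulTop x X)).1 ⟨rs, by simpa using h1, fun r hr => h2 r (by simp [hr]), h3.2⟩
        apply sub_of_NS R
        refine L4 _ i x h3.1 hx ?_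
        have := h4 (i+1) (by omega)
        exact NS_of_subsingleton _
    · intro H
      obtain ⟨x, hx, hreg⟩ := exists_reg (X := X) (IsLocalRing.maximalIdeal R) (by
        intro q hq hle
        have hqm : q = IsLocalRing.maximalIdeal R :=
          le_antisymm (IsLocalRing.le_maximalIdeal (IsAssociatedPrime.isPrime hq).ne_top) hle
        subst hqm
        have h1 := assSupp hG (mm R) hq
        rw [dq_mm] at h1
        have := H n (by omega)
        exact NS_of_subsingleton (X := EE R n X) _ h1)
      have := hnt x hx
      obtain ⟨rs, h1, h2, h3⟩ := (ih (QuotSMulTop x X)).2 (by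
        intro i hi
        apply sub_of_NS R
        cases i with
        | zero =>
          have := H 0 (by omega)
          exact L0 (x • (LinearMap.id : X →ₗ[R] X))
            (Submodule.mkQ (x • (⊤ : Submodule R X))) hreg (Submodule.mkQ_surjective _) (smul_exact x)
            _ (NS_of_subsingleton _)
        | succ j =>
          have := H j (by omega)
          have := H (j+1) (by omega)
          exact L2 (x • (LinearMap.id : X →ₗ[R] X))
            (Submodule.mkQ (x • (⊤ : Submodule R X))) hreg (Submodule.mkQ_surjective _) (smul_exact x)
            _ _ (NS_of_subsingleton _) (NS_of_subsingleton _))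
      refine ⟨x :: rs, by simp [h1], ?_, ?_⟩
      · intro r hr
        rcases List.mem_cons.1 hr with rfl | hr
        · exact hx
        · exact h2 r hr
      · rw [RingTheory.Sequence.isRegular_cons_iff]
        exact ⟨hreg, h3⟩

lemma depth_iff (t : ℕ) (X : Type) [AddCommGroup X] [Module R X] [Module.Finite R X] [Nontrivial X] :
    (t : ℕ∞) ≤ moduleDepth R X ↔ ∀ i, n < i + t → Subsingleton (EE R i X) := by
  constructor
  · intro h i hi
    obtain ⟨s, hs, h1⟩ := depth_exists t h
    exact (F3 hG s X).1 h1 i (by omega)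
  · intro h
    exact depth_ge t ((F3 hG t X).2 h)
end dep

section hom
variable {R : Type} [CommRing R] [IsNoetherianRing R] [IsLocalRing R]
variable {X Y Z : Type} [AddCommGroup X] [Module R X] [AddCommGroup Y] [Module R Y]
  [AddCommGroup Z] [Module R Z]

/-- vanishing -/
abbrev VE (R : Type) [CommRing R] (i : ℕ) (X : Type) [AddCommGroup X] [Module R X] : Prop := Subsingleton (EE R i X)

lemma sub_exact {f : X →ₗ[R] Y} {g : Y →ₗ[R] Z} (h : Function.Exact f g) 
    (hX : Subsingleton X) (hZ : Subsingleton Z) : Subsingleton Y := by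
  refine ⟨fun a b => ?_⟩
  have key : ∀ a : Y, a = 0 := by
    intro a
    obtain ⟨x, hx⟩ := (h a).1 (Subsingleton.elim _ _)
    rw [← hx, Subsingleton.elim x 0, map_zero]
  rw [key a, key b]


lemma VE_congr (i : ℕ) (e : X ≃ₗ[R] Y) : VE R i X ↔ VE R i Y :=
  (EEcongr i e).toEquiv.symm.subsingleton_congr

section
variable {f : X →ₗ[R] Y} {g : Y →ₗ[R] Z} (hf : Function.Injective f)
    (hg : Function.Surjective g) (h : Function.Exact f g) (i : ℕ)
include hf hg h

lemma S1 (h1 : VE R i Z) (h2 : VE R i X) : VE R i Y := by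
  obtain ⟨δ, e1, e2, e3, -⟩ := les f g hf hg h
  exact sub_exact (e1 i) h1 h2

lemma S2 (h1 : VE R i X) (h2 : VE R (i+1) Y) : VE R (i+1) Z := by
  obtain ⟨δ, e1, e2, e3, -⟩ := les f g hf hg h
  exact sub_exact (e3 i) h1 h2

lemma S3 (h1 : VE R i Y) (h2 : VE R (i+1) Z) : VE R i X := by
  obtain ⟨δ, e1, e2, e3, -⟩ := les f g hf hg h
  exact sub_exact (e2 i) h1 h2

lemma shift (h1 : VE R i Y) (h2 : VE R (i+1) Y) : Nonempty (EE R i X ≃ₗ[R] EE R (i+1) Z) := by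
  obtain ⟨δ, e1, e2, e3, -⟩ := les f g hf hg h
  refine ⟨LinearEquiv.ofBijective (δ i) ⟨?_, ?_⟩⟩
  · rw [← LinearMap.ker_eq_bot, LinearMap.ker_eq_bot']
    intro a ha
    obtain ⟨b, rfl⟩ := (e2 i a).1 ha
    rw [Subsingleton.elim b 0, map_zero]
  · intro a
    exact (e3 i a).1 (Subsingleton.elim _ _)
end

lemma dualseq {k : ℕ} (g : (Fin k → R) →ₗ[R] Z) (hg : Function.Surjective g) :
    Module.Projective R (EE R 0 (Fin k → R)) ∧
    (∀ i, Nonempty (EE R (i+1) (LinearMap.ker g) ≃ₗ[R] EE R (i+2) Z)) ∧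
    ∃ (B : Submodule R (EE R 0 (LinearMap.ker g))) (u : EE R 0 Z →ₗ[R] EE R 0 (Fin k → R))
      (v : EE R 0 (Fin k → R) →ₗ[R] B) (w : EE R 0 (LinearMap.ker g) →ₗ[R] EE R 1 Z),
      Function.Injective u ∧ Function.Surjective v ∧ Function.Exact u v ∧
      Function.Surjective w ∧ Function.Exact B.subtype w := by
  have hex := LinearMap.exact_subtype_ker_map g
  have hin : Function.Injective (LinearMap.ker g).subtype := Subtype.val_injective
  refine ⟨Module.Projective.of_equiv (EEzero (R := R) (X := Fin k → R)).symm, ?_, ?_⟩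
  · intro i
    exact shift hin hg hex _ (EE_proj _) (EE_proj _)
  · obtain ⟨δ, e1, e2, e3, e4⟩ := les _ g hin hg hex
    refine ⟨LinearMap.range (pre 0 (LinearMap.ker g).subtype), pre 0 g, LinearMap.rangeRestrict _,
      δ 0, e4, LinearMap.surjective_rangeRestrict _, ?_, ?_, ?_⟩
    · intro a
      rw [← e1 0 a, ← Submodule.coe_eq_zero]
      rfl
    · intro a
      have : VE R 1 (Fin k → R) := EE_proj 0
      exact (e3 0 a).1 (Subsingleton.elim (α := EE R 1 (Fin k → R)) _ _)
    · intro a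
      rw [e2 0 a]
      simp

lemma syzaux {M : Type} [AddCommGroup M] [Module R M] [Module.Finite R M] (g j : ℕ)
    (hv : ∀ i < g, VE R i M) (hj : j < g) :
    ∃ (N : Type) (_ : AddCommGroup N) (_ : Module R N), Module.Finite R N ∧
      (∀ l, Nonempty (EE R (l+1) N ≃ₗ[R] EE R (l+1+j) M)) ∧ ∀ i ≥ j, VE R i (EE R 0 N) := by
  induction j with
  | zero =>
    refine ⟨M, _, _, inferInstance, fun l => ⟨LinearEquiv.refl _ _⟩, fun i _ => ?_⟩
    have := hv 0 hj
    exact sub_of_NS R (NS_EE _ (NS_of_subsingleton _) i)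
  | succ j ih =>
    obtain ⟨N, _, _, hN, h1, h2⟩ := ih (by omega)
    obtain ⟨k, g', hg'⟩ := Module.Finite.exists_fin' R N
    obtain ⟨hP, hs, B, u, v, w, hu, hv', huv, hw, hBw⟩ := dualseq g' hg'
    refine ⟨LinearMap.ker g', inferInstance, inferInstance, inferInstance, ?_, ?_⟩
    · intro l
      obtain ⟨e⟩ := hs l
      obtain ⟨e'⟩ := h1 (l+1)
      rw [show l + 1 + (j+1) = l + 1 + 1 + j by omega]
      exact ⟨e.trans e'⟩
    · intro i hi
      obtain ⟨i', rfl⟩ : ∃ i', i = i' + 1 := ⟨i - 1, by omega⟩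
      have hB : VE R (i'+1) B := S2 hu hv' huv i' (h2 i' (by omega)) (EE_proj _)
      have h3 : VE R 1 N := by
        obtain ⟨e'⟩ := h1 0
        have := hv (0+1+j) (by omega)
        exact e'.toEquiv.subsingleton
      have h4 : VE R (i'+1) (EE R 1 N) := sub_of_NS R (NS_EE _ (NS_of_subsingleton _) _)
      exact S1 Subtype.val_injective hw hBw _ h4 hB

lemma EE_idx {M : Type} [AddCommGroup M] [Module R M] {i j : ℕ} (h : i = j) :
    Nonempty (EE R i M ≃ₗ[R] EE R j M) := by subst h; exact ⟨LinearEquiv.refl _ _⟩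

lemma syz {M : Type} [AddCommGroup M] [Module R M] [Module.Finite R M] (g : ℕ)
    (hv : ∀ i < g, VE R i M) :
    ∃ (N : Type) (_ : AddCommGroup N) (_ : Module R N), Module.Finite R N ∧
      (∀ l, Nonempty (EE R (l+1) N ≃ₗ[R] EE R (l+1+g) M)) ∧
      ∀ i ≥ g+1, VE R i (EE R g M) ↔ VE R i (EE R 0 N) := by
  cases g with
  | zero => exact ⟨M, _, _, inferInstance, fun l => ⟨LinearEquiv.refl _ _⟩, fun i _ => Iff.rfl⟩
  | succ j =>
    obtain ⟨N, _, _, hN, h1, h2⟩ := syzaux (j+1) j hv (by omega)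
    obtain ⟨k, g', hg'⟩ := Module.Finite.exists_fin' R N
    obtain ⟨hP, hs, B, u, v, w, hu, hv', huv, hw, hBw⟩ := dualseq g' hg'
    refine ⟨LinearMap.ker g', inferInstance, inferInstance, inferInstance, ?_, ?_⟩
    · intro l
      obtain ⟨e⟩ := hs l
      obtain ⟨e'⟩ := h1 (l+1)
      rw [show l + 1 + (j+1) = l + 1 + 1 + j by omega]
      exact ⟨e.trans e'⟩
    · intro i hi
      obtain ⟨i', rfl⟩ : ∃ i', i = i' + 2 := ⟨i - 2, by omega⟩
      have hB : VE R (i'+1) B := S2 hu hv' huv i' (h2 i' (by omega)) (EE_proj _)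
      have hB' : VE R (i'+2) B := S2 hu hv' huv (i'+1) (h2 (i'+1) (by omega)) (EE_proj _)
      obtain ⟨e'⟩ := h1 0
      obtain ⟨e''⟩ := EE_idx (R := R) (M := M) (show 0+1+j = j+1 by omega)
      rw [← VE_congr (i'+2) (e'.trans e'')]
      constructor
      · intro h
        exact S1 Subtype.val_injective hw hBw _ h hB'
      · intro h
        exact S2 Subtype.val_injective hw hBw _ hB h

variable {n : ℕ} (hG : ∀ i, i ≠ n → Subsingleton (EE R i (R ⧸ IsLocalRing.maximalIdeal R)))
include hG

lemma mcm (k : ℕ) (i : ℕ) (hi : n < i + 1 + k) (N : Type) [AddCommGroup N] [Module R N]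
    [Module.Finite R N] (hN : ∀ l, VE R (l+1) N) : VE R (i+1) (EE R 0 N) := by
  induction k generalizing i N with
  | zero => exact F1m hG _ (by omega)
  | succ k ih =>
    obtain ⟨r, g', hg'⟩ := Module.Finite.exists_fin' R N
    obtain ⟨hP, hs, B, u, v, w, hu, hv', huv, hw, hBw⟩ := dualseq g' hg'
    have h1 := ih (i+1) (by omega) (LinearMap.ker g') (fun l => by
      obtain ⟨e⟩ := hs l
      have := hN (l+1)
      exact e.toEquiv.subsingleton)
    have h3 : VE R 1 N := hN 0
    have hB : VE R (i+1+1) B := S3 Subtype.val_injective hw hBw _ h1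
      (sub_of_NS R (NS_EE _ (NS_of_subsingleton _) _))
    exact S3 hu hv' huv _ (EE_proj _) hB

lemma dual2 (N : Type) [AddCommGroup N] [Module R N]
    [Module.Finite R N] (hN : ∀ l, VE R (l+2) N) (i : ℕ) :
    VE R (i+1) (EE R 0 N) ↔ VE R (i+3) (EE R 1 N) := by
  obtain ⟨r, g', hg'⟩ := Module.Finite.exists_fin' R N
  obtain ⟨hP, hs, B, u, v, w, hu, hv', huv, hw, hBw⟩ := dualseq g' hg'
  have h1 : ∀ i, VE R (i+1) (EE R 0 (LinearMap.ker g')) := fun i =>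
    mcm hG n i (by omega) (LinearMap.ker g') (fun l => by
      obtain ⟨e⟩ := hs l
      have := hN l
      exact e.toEquiv.subsingleton)
  constructor
  · intro h
    have hB : VE R (i+2) B := S2 hu hv' huv _ h (EE_proj _)
    exact S2 Subtype.val_injective hw hBw _ hB (h1 (i+2))
  · intro h
    have hB : VE R (i+2) B := S3 Subtype.val_injective hw hBw _ (h1 (i+1)) h
    exact S3 hu hv' huv _ (EE_proj _) hB

lemma duality {M : Type} [AddCommGroup M] [Module R M] [Module.Finite R M] (g : ℕ)
    (hv : ∀ i < g, VE R i M) (hv' : ∀ i, g + 1 < i → VE R i M) (i : ℕ) (hi : g + 1 ≤ i) :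
    VE R i (EE R g M) ↔ VE R (i+2) (EE R (g+1) M) := by
  obtain ⟨N, _, _, hN, h1, h2⟩ := syz g hv
  rw [h2 i hi]
  obtain ⟨i', rfl⟩ : ∃ i', i = i' + 1 := ⟨i - 1, by omega⟩
  rw [dual2 hG N (fun l => by
    obtain ⟨e⟩ := h1 (l+1)
    have := hv' (l+1+1+g) (by omega)
    exact e.toEquiv.subsingleton)]
  obtain ⟨e'⟩ := h1 0
  obtain ⟨e''⟩ := EE_idx (R := R) (M := M) (show 0+1+g = g+1 by omega)
  exact VE_congr (i'+3) (e'.trans e'')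
end hom

section loc
variable {A : Type} [CommRing A] [IsNoetherianRing A] {M : Type} [AddCommGroup M] [Module A M]
  [Module.Finite A M] (P : PrimeSpectrum A)

lemma loc_ass (x : A) (h : IsLocalRing.maximalIdeal (Localization.AtPrime P.asIdeal) ∈
    associatedPrimes (Localization.AtPrime P.asIdeal)
      (QuotSMulTop (algebraMap A (Localization.AtPrime P.asIdeal) x)
        (LocalizedModule P.asIdeal.primeCompl M))) :
    P.asIdeal ∈ associatedPrimes A (QuotSMulTop x M) := by
  let S := Localization.AtPrime P.asIdeal
  let f := LocalizedModule.mkLinearMap P.asIdeal.primeCompl M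
  have hf : IsBaseChange S f := IsLocalizedModule.isBaseChange P.asIdeal.primeCompl S f
  let e := (QuotSMulTop.algebraMapTensorEquivTensorQuotSMulTop x M S).symm ≪≫ₗ
      QuotSMulTop.congr ((algebraMap A S) x) hf.equiv
  let gm := e.toLinearMap.restrictScalars A ∘ₗ TensorProduct.mk A S (QuotSMulTop x M) 1
  have hg : IsBaseChange S gm :=
      IsBaseChange.of_equiv e (fun _ ↦ rfl)
  have hl := (isLocalizedModule_iff_isBaseChange P.asIdeal.primeCompl S gm).2 hg
  have := Module.associatedPrimes.comap_mem_associatedPrimes_of_mem_associatedPrimes_of_isLocalizedModule_of_fg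
    P.asIdeal.primeCompl gm _ h (IsNoetherian.noetherian _)
  have he : Ideal.comap (algebraMap A (Localization.AtPrime P.asIdeal))
      (IsLocalRing.maximalIdeal (Localization.AtPrime P.asIdeal)) = P.asIdeal :=
    Localization.AtPrime.under_maximalIdeal (I := P.asIdeal)
  rwa [he] at this

lemma loc_supp (Q : PrimeSpectrum (Localization.AtPrime P.asIdeal))
    (h : Q ∈ Module.support (Localization.AtPrime P.asIdeal)
      (LocalizedModule P.asIdeal.primeCompl M)) :
    PrimeSpectrum.comap (algebraMap A _) Q ∈ Module.support A M := by
  by_contra hc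
  rw [Module.notMem_support_iff'] at hc
  refine absurd h ?_
  rw [Module.notMem_support_iff']
  intro m
  induction m using LocalizedModule.induction_on with
  | h m s =>
  obtain ⟨r, hr, h1⟩ := hc m
  refine ⟨algebraMap A _ r, hr, ?_⟩
  rw [algebraMap_smul, LocalizedModule.smul'_mk, h1, LocalizedModule.zero_mk]

lemma loc_lt (Q Q' : PrimeSpectrum (Localization.AtPrime P.asIdeal)) (h : Q < Q') :
    PrimeSpectrum.comap (algebraMap A _) Q < PrimeSpectrum.comap (algebraMap A _) Q' := by
  refine lt_of_le_of_ne (Ideal.comap_mono h.le) fun he => h.ne ?_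
  exact PrimeSpectrum.localization_comap_injective _ P.asIdeal.primeCompl he

lemma loc_le (Q : PrimeSpectrum (Localization.AtPrime P.asIdeal)) :
    PrimeSpectrum.comap (algebraMap A _) Q ≤ P := by
  change Ideal.comap _ _ ≤ P.asIdeal
  refine (Ideal.comap_mono (IsLocalRing.le_maximalIdeal Q.2.ne_top)).trans ?_
  exact (Localization.AtPrime.under_maximalIdeal (I := P.asIdeal)).le

lemma wlemma (a : WithBot ℕ∞) (b : ℕ∞) (h1 : ((1:ℕ) : WithBot ℕ∞) ≤ a → ((1:ℕ) : ℕ∞) ≤ b)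
    (h2 : ((2:ℕ) : WithBot ℕ∞) ≤ a → ((2:ℕ):ℕ∞) ≤ b) : min 2 a ≤ (b : WithBot ℕ∞) := by
  induction a using WithBot.recBotCoe with
  | bot => simp
  | coe a =>
    have e1 : ((1:ℕ) : WithBot ℕ∞) ≤ a ↔ ((1:ℕ) : ℕ∞) ≤ a :=
      WithBot.coe_le_coe (a := ((1:ℕ) : ℕ∞))
    have e2 : ((2:ℕ) : WithBot ℕ∞) ≤ a ↔ ((2:ℕ) : ℕ∞) ≤ a :=
      WithBot.coe_le_coe (a := ((2:ℕ) : ℕ∞))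
    rw [e1] at h1
    rw [e2] at h2
    have : (min 2 (a : WithBot ℕ∞)) = ((min (2:ℕ) a : ℕ∞) : WithBot ℕ∞) := by
      rw [WithBot.coe_min]; rfl
    rw [this, WithBot.coe_le_coe]
    induction a using ENat.recTopCoe with
    | top => simpa using h2 le_top
    | coe a =>
      match a with
      | 0 => simp
      | 1 => exact (min_le_right _ _).trans (h1 le_rfl)
      | (k+2) => exact (min_le_left _ _).trans (h2 (by norm_cast; omega))

lemma S2crit (H : ∀ P q0 : PrimeSpectrum A, q0 ∈ Module.support A M → q0 < P →
    ∃ x ∈ P.asIdeal, IsSMulRegular M x ∧ ∀ q q1, q ∈ Module.support A M → q < q1 → q1 < P →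
      P.asIdeal ∉ associatedPrimes A (QuotSMulTop x M)) : SerreS2 A M := by
  intro P' hP'
  obtain ⟨P, rfl⟩ : ∃ P : PrimeSpectrum A, P' = P.asIdeal := ⟨⟨P', hP'⟩, rfl⟩
  set S := Localization.AtPrime P.asIdeal
  set N := LocalizedModule P.asIdeal.primeCompl M
  have hfin : Module.Finite S N :=
    Module.Finite.of_isLocalizedModule P.asIdeal.primeCompl (LocalizedModule.mkLinearMap P.asIdeal.primeCompl M)
  have hreg : ∀ x ∈ P.asIdeal, IsSMulRegular M x → IsSMulRegular N (algebraMap A S x) ∧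
      algebraMap A S x ∈ IsLocalRing.maximalIdeal S := by
    intro x hx hr
    constructor
    · have h1 : RingTheory.Sequence.IsWeaklyRegular M [x] := by simpa using hr
      have := h1.of_isLocalizedModule S P.asIdeal.primeCompl
        (LocalizedModule.mkLinearMap P.asIdeal.primeCompl M)
      simpa using this
    · exact (IsLocalization.AtPrime.to_map_mem_maximal_iff S P.asIdeal x).2 hx
  apply wlemma
  · intro h
    rw [moduleDim, Order.le_krullDim_iff] at h
    obtain ⟨l, hl⟩ := h
    have hlt : l 0 < l (Fin.last _) := l.strictMono (by simp [Fin.lt_def, hl])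
    obtain ⟨x, hx, hr, -⟩ := H P _ (loc_supp P _ (l 0).2)
      (lt_of_lt_of_le (loc_lt P (l 0).1 (l (Fin.last _)).1 hlt) (loc_le P _))
    obtain ⟨h1, h2⟩ := hreg x hx hr
    have : Nontrivial N := (Module.nonempty_support_iff (R := S)).1 ⟨_, (l 0).2⟩
    apply depth_ge
    refine ⟨[algebraMap A S x], rfl, by simpa using h2, ?_⟩
    rw [IsLocalRing.isRegular_iff_isWeaklyRegular_of_subset_maximalIdeal (by simpa using h2)]
    simpa using h1
  · intro h
    rw [moduleDim, Order.le_krullDim_iff] at h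
    obtain ⟨l, hl⟩ := h
    have hlt : l 0 < l ⟨1, by omega⟩ := l.strictMono (by simp [Fin.lt_def])
    have hlt' : l ⟨1, by omega⟩ < l ⟨2, by omega⟩ := l.strictMono (by simp [Fin.lt_def])
    have hlt2 := lt_of_lt_of_le (loc_lt P (l ⟨1, by omega⟩).1 (l ⟨2, by omega⟩).1 hlt') (loc_le P _)
    have hlt1 := loc_lt P (l 0).1 (l ⟨1, by omega⟩).1 hlt
    obtain ⟨x, hx, hr, hno⟩ := H P _ (loc_supp P _ (l 0).2) (hlt1.trans hlt2)
    have hno := hno _ _ (loc_supp P _ (l 0).2) hlt1 hlt2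
    obtain ⟨h1, h2⟩ := hreg x hx hr
    have : Nontrivial N := (Module.nonempty_support_iff (R := S)).1 ⟨_, (l 0).2⟩
    have hS : IsNoetherianRing S := IsLocalization.isNoetherianRing P.asIdeal.primeCompl S inferInstance
    obtain ⟨y, hy, hyr⟩ := exists_reg (R := S) (X := QuotSMulTop (algebraMap A S x) N)
      (IsLocalRing.maximalIdeal S) (by
        intro q hq hle
        have hqm : q = IsLocalRing.maximalIdeal S :=
          le_antisymm (IsLocalRing.le_maximalIdeal (IsAssociatedPrime.isPrime hq).ne_top) hle
        subst hqm
        exact hno (loc_ass P x hq))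
    apply depth_ge
    have hmem : ∀ r ∈ [algebraMap A S x, y], r ∈ IsLocalRing.maximalIdeal S := by
      intro r hr
      simp only [List.mem_cons, List.not_mem_nil, or_false] at hr
      rcases hr with rfl | rfl
      · exact h2
      · exact hy
    refine ⟨[algebraMap A S x, y], rfl, hmem, ?_⟩
    rw [IsLocalRing.isRegular_iff_isWeaklyRegular_of_subset_maximalIdeal hmem]
    rw [RingTheory.Sequence.isWeaklyRegular_cons_iff]
    refine ⟨h1, ?_⟩
    simpa using hyr
end loc

lemma cast_inj' (a b : ℕ) : (a : WithBot ℕ∞) = ((b : ℕ∞) : WithBot ℕ∞) ↔ a = b := by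
  rw [show ((a : ℕ) : WithBot ℕ∞) = ((a : ℕ∞) : WithBot ℕ∞) from rfl, WithBot.coe_inj, Nat.cast_inj]

lemma cast_le' {a b : ℕ} (h : a ≤ b) : (a : WithBot ℕ∞) ≤ (b : WithBot ℕ∞) :=
  WithBot.coe_le_coe.2 (Nat.cast_le.2 h : (a : ℕ∞) ≤ b)

section congr
variable {R : Type} [CommRing R] {X Y : Type} [AddCommGroup X] [Module R X] [AddCommGroup Y]
  [Module R Y] (e : X ≃ₗ[R] Y)
include e

lemma dim_congr : moduleDim R X = moduleDim R Y := by
  rw [moduleDim, moduleDim, e.support_eq]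

lemma depth_congr [IsLocalRing R] : moduleDepth R X = moduleDepth R Y := by
  rw [moduleDepth, moduleDepth]
  simp only [e.isRegular_congr]

lemma CM_congr [IsLocalRing R] : IsCM R X ↔ IsCM R Y := by
  rw [IsCM, IsCM, dim_congr e, depth_congr e, e.toEquiv.subsingleton_congr]
end congr

section ass
variable {A : Type} [CommRing A] [IsNoetherianRing A] {M : Type} [AddCommGroup M] [Module A M]

lemma ass_iff0 (I : Ideal A) : I ∈ associatedPrimes A M ↔
    I.IsPrime ∧ ∃ m : M, ∀ a, a ∈ I ↔ a • m = 0 := by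
  change IsAssociatedPrime I M ↔ _
  rw [isAssociatedPrime_iff]
  refine and_congr_right fun _ => exists_congr fun m => ?_
  rw [SetLike.ext_iff]
  refine forall_congr' fun a => ?_
  rw [Submodule.mem_colon_singleton, Submodule.mem_bot]

lemma ass_iff (I : Ideal A) (y : A) : I ∈ associatedPrimes A (QuotSMulTop y M) ↔
    I.IsPrime ∧ ∃ m : M, ∀ a, a ∈ I ↔ ∃ m', y • m' = a • m := by
  rw [ass_iff0]
  refine and_congr_right fun _ => ?_
  rw [(Submodule.mkQ_surjective (y • (⊤ : Submodule A M))).exists]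
  refine exists_congr fun m => forall_congr' fun a => ?_
  rw [← map_smul, Submodule.mkQ_apply, Submodule.Quotient.mk_eq_zero,
    Submodule.mem_smul_pointwise_iff_exists]
  simp
end ass

section core
variable {R : Type} [CommRing R] [IsNoetherianRing R] [IsLocalRing R]

lemma dim_eq (X : Type) [AddCommGroup X] [Module R X] (c : ℕ)
    (h1 : ∀ p ∈ Module.support R X, dq p ≤ c) (h2 : ∃ p ∈ Module.support R X, dq p = c) :
    moduleDim R X = c := by
  apply le_antisymm
  · rw [moduleDim, Order.krullDim]
    refine iSup_le fun l => ?_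
    have h3 : (l.length : ℕ∞) ≤ Order.coheight (l.head).1 :=
      (Order.length_le_coheight_head (p := l)).trans
        (Order.coheight_le_coheight_apply_of_strictMono (fun p : Module.support R X => p.1)
          (fun _ _ h => h) _)
    rw [← dq_coe] at h3
    have h4 := h1 _ (l.head).2
    have h5 : l.length ≤ dq (l.head).1 := by exact_mod_cast h3
    exact cast_le' (h5.trans h4)
  · obtain ⟨p, hp, rfl⟩ := h2
    have : ((dq p : ℕ∞) : WithBot ℕ∞) ≤ moduleDim R X := by
      rw [dq_coe, Order.coheight_eq_krullDim_Ici, moduleDim]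
      exact Order.krullDim_le_of_strictMono
        (fun q : Set.Ici p => (⟨q.1, Module.mem_support_mono q.2 hp⟩ : Module.support R X))
        (fun _ _ h => h)
    exact this

lemma supp_has_ass (M : Type) [AddCommGroup M] [Module R M] [Module.Finite R M]
    (q : PrimeSpectrum R) (hq : q ∈ Module.support R M) :
    ∃ p : PrimeSpectrum R, p.asIdeal ∈ associatedPrimes R M ∧ p ≤ q := by
  rw [Module.mem_support_iff_of_finite] at hq
  obtain ⟨p, hp, hpq⟩ := Ideal.exists_minimalPrimes_le hq
  exact ⟨⟨p, hp.1.1⟩, Module.associatedPrimes.minimalPrimes_annihilator_subset_associatedPrimes R M hp, hpq⟩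

variable {n : ℕ} (hG : ∀ i, i ≠ n → Subsingleton (EE R i (R ⧸ IsLocalRing.maximalIdeal R)))
include hG

lemma depth_le (X : Type) [AddCommGroup X] [Module R X] [Module.Finite R X] [Nontrivial X] (c t : ℕ)
    (h1 : ∀ p ∈ Module.support R X, dq p ≤ c) (h : (t : ℕ∞) ≤ moduleDepth R X) : t ≤ c := by
  rw [depth_iff hG] at h
  obtain ⟨q, hq⟩ := (Module.nonempty_support_iff (R := R) (M := X)).2 inferInstance
  obtain ⟨p, hp, hpq⟩ := supp_has_ass X q hq
  have h2 := assSupp hG p hp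
  by_contra hc
  have h4 := (gg3 hG p).1
  have h5 : p ∈ Module.support R X := by
    by_contra h6; exact NS_EE p h6 _ h2
  have := h1 p h5
  have h3 := h (n - dq p) (by omega)
  exact NS_of_subsingleton _ h2

variable {M : Type} [AddCommGroup M] [Module R M] [Module.Finite R M] [Nontrivial M] {d : ℕ}
  (hAss : ∀ p : PrimeSpectrum R, p.asIdeal ∈ associatedPrimes R M → dq p = d)
include hAss

lemma d_le_n : d ≤ n := by
  obtain ⟨q, hq⟩ := (Module.nonempty_support_iff (R := R) (M := M)).2 inferInstance
  obtain ⟨p, hp, hpq⟩ := supp_has_ass M q hq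
  rw [← hAss p hp]
  exact (gg3 hG p).1

omit hG in
lemma supp_le (q : PrimeSpectrum R) (hq : q ∈ Module.support R M) : dq q ≤ d := by
  obtain ⟨p, hp, hpq⟩ := supp_has_ass M q hq
  rw [← hAss p hp]
  exact dq_anti' hpq

omit hG in
lemma exists_reg' (p : PrimeSpectrum R) (h : dq p < d) : ∃ x ∈ p.asIdeal, IsSMulRegular M x := by
  apply exists_reg
  intro q hq hle
  have := hAss ⟨q, IsAssociatedPrime.isPrime hq⟩ hq
  have h2 : p ≤ ⟨q, IsAssociatedPrime.isPrime hq⟩ := hle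
  have := dq_anti' h2
  omega

lemma dimD_le (hd : 2 ≤ d) (p : PrimeSpectrum R) (hp : p ∈ Module.support R (EE R (n-d+1) M)) :
    dq p ≤ d - 2 := by
  have hdn := d_le_n hG hAss
  by_contra hc
  by_cases h : n < (n-d+1) + dq p
  · exact F1 hG p _ h hp
  · obtain ⟨x, hx, hr⟩ := exists_reg' hAss p (by omega)
    refine L4 p _ x hr hx ?_ hp
    apply F1 hG
    omega

variable (hdep : ∀ i, n < i + (d - 1) → VE R i M)
include hdep

lemma notass (p : PrimeSpectrum R) (x : R) (hx : x ∈ p.asIdeal) (hr : IsSMulRegular M x)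
    (hp : dq p + 2 ≤ d) (hno : dq p + 2 = d → NS p (EE R (n-d+1) M)) :
    p.asIdeal ∉ associatedPrimes R (QuotSMulTop x M) := by
  intro hc
  have hdn := d_le_n hG hAss
  have h1 := assSupp hG p hc
  obtain ⟨j, hj⟩ : ∃ j, n - dq p = j + 1 := ⟨n - dq p - 1, by omega⟩
  rw [hj] at h1
  refine L2 (x • (LinearMap.id : M →ₗ[R] M))
            (Submodule.mkQ (x • (⊤ : Submodule R M))) hr (Submodule.mkQ_surjective _) (smul_exact x)
            p j ?_ ?_ h1
  · by_cases h2 : dq p + 2 = d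
    · rw [show j = n - d + 1 by omega]
      exact hno h2
    · have := hdep j (by omega)
      exact NS_of_subsingleton _
  · refine L4 p _ x hr hx ?_
    apply F1 hG
    omega

lemma final (hex : ∃ p ∈ Module.support R (EE R (n-d+1) M), dq p + 2 = d) :
    2 ≤ d ∧ d ≤ n ∧
    moduleDim R (EE R (n-d+1) M) = ((d - 2 : ℕ) : WithBot ℕ∞) ∧
    moduleDepth R (EE R (n-d+1) M) = moduleDepth R (EE R (n-d) M) - 2 ∧
    (IsCM R (EE R (n-d+1) M) ↔ IsCM R (EE R (n-d) M)) := by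
  have hdn := d_le_n hG hAss
  obtain ⟨p0, hp0, hp0d⟩ := hex
  have hd : 2 ≤ d := by omega
  have hD : Nontrivial (EE R (n-d+1) M) := (Module.nonempty_support_iff (R := R)).1 ⟨_, hp0⟩
  have hDle := dimD_le hG hAss hd
  have hDdim := dim_eq (EE R (n-d+1) M) (d-2) hDle ⟨p0, hp0, by omega⟩
  have hKle : ∀ p ∈ Module.support R (EE R (n-d) M), dq p ≤ d := by
    intro p hp
    apply supp_le hAss
    by_contra hc
    exact NS_EE p hc _ hp
  have hKex : ∃ p ∈ Module.support R (EE R (n-d) M), dq p = d := by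
    obtain ⟨q, hq⟩ := (Module.nonempty_support_iff (R := R) (M := M)).2 inferInstance
    obtain ⟨p, hp, hpq⟩ := supp_has_ass M q hq
    refine ⟨p, ?_, hAss p hp⟩
    have := assSupp hG p hp
    rwa [hAss p hp] at this
  have hK : Nontrivial (EE R (n-d) M) :=
    (Module.nonempty_support_iff (R := R)).1 ⟨_, hKex.choose_spec.1⟩
  have hKdim := dim_eq (EE R (n-d) M) d hKle hKex
  have hdual := duality hG (M := M) (n-d)
    (fun i hi => F2 hG i d (supp_le hAss) (by omega)) (fun i hi => hdep i (by omega))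
  have hDd := fun t => depth_le hG (EE R (n-d+1) M) (d-2) t hDle
  have hKd := fun t => depth_le hG (EE R (n-d) M) d t hKle
  have key : ∀ t : ℕ, (t : ℕ∞) ≤ moduleDepth R (EE R (n-d+1) M) ↔
      ((t + 2 : ℕ) : ℕ∞) ≤ moduleDepth R (EE R (n-d) M) := by
    intro t
    constructor
    · intro h
      have ht := hDd t h
      rw [depth_iff hG] at h ⊢
      intro i hi
      exact (hdual i (by omega)).2 (h (i+2) (by omega))
    · intro h
      have ht := hKd _ h
      rw [depth_iff hG] at h ⊢
      intro i hi
      obtain ⟨i', rfl⟩ : ∃ i', i = i' + 2 := ⟨i - 2, by omega⟩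
      exact (hdual i' (by omega)).1 (h i' (by omega))
  refine ⟨hd, hdn, hDdim, ?_⟩
  rw [IsCM, IsCM, hDdim, hKdim]
  have hsD : ¬ Subsingleton (EE R (n-d+1) M) := not_subsingleton_iff_nontrivial.2 hD
  have hsK : ¬ Subsingleton (EE R (n-d) M) := not_subsingleton_iff_nontrivial.2 hK
  simp only [hsD, hsK, false_or]
  generalize moduleDepth R (EE R (n-d+1) M) = a at *
  generalize moduleDepth R (EE R (n-d) M) = b at *
  have ha : a ≠ ⊤ := by
    rintro rfl
    have := hDd (d+1) le_top
    omega
  have hb : b ≠ ⊤ := by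
    rintro rfl
    have := hKd (d+1) le_top
    omega
  lift a to ℕ using ha
  lift b to ℕ using hb
  have k0 : 2 ≤ b := by simpa using (key 0).1 (by simp)
  have k1 : a + 2 ≤ b := by exact_mod_cast (key a).1 le_rfl
  have k2 : b - 2 ≤ a := by
    have := (key (b-2)).2 (by norm_cast; omega)
    exact_mod_cast this
  have hab : b = a + 2 := by omega
  subst hab
  constructor
  · have : ((a + 2 : ℕ) : ℕ∞) - ((2:ℕ) : ℕ∞) = ((a + 2 - 2 : ℕ) : ℕ∞) := (ENat.natCast_sub _ _).symm
    rw [Nat.add_sub_cancel] at this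
    exact this.symm
  · refine (cast_inj' (d-2) a).trans (Iff.trans ?_ (cast_inj' d (a+2)).symm)
    omega
end core

lemma stmt_aux
    (R : Type) [CommRing R] [IsLocalRing R] (hGor : IsGorensteinLocalRing R)
    (n : ℕ) (hn : ringKrullDim R = n)
    (A : Type) [CommRing A] [IsLocalRing A] [IsNoetherianRing A]
    (π : R →+* A) (hπ : Function.Surjective π)
    (M : Type) [AddCommGroup M] [Module A M] [Module R M] [Module.Finite A M]
    (hcompat : ∀ (r : R) (m : M), π r • m = r • m)
    (d : ℕ) (hd : moduleDim A M = d)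
    (hunmixed : IsUnmixed A M) (hnotS2 : ¬ SerreS2 A M)
    (hdepth : moduleDepth A M = (d - 1 : ℕ)) :
    2 ≤ d ∧ d ≤ n ∧
    moduleDim R (EE R (n-d+1) M) = ((d - 2 : ℕ) : WithBot ℕ∞) ∧
    moduleDepth R (EE R (n-d+1) M) = moduleDepth R (EE R (n-d) M) - 2 ∧
    (IsCM R (EE R (n-d+1) M) ↔ IsCM R (EE R (n-d) M)) := by
  obtain ⟨hN, hGor⟩ := hGor
  have hG : ∀ i, i ≠ n → Subsingleton (EE R i (R ⧸ IsLocalRing.maximalIdeal R)) := by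
    intro i hi
    have := (hGor n hn).1 i hi
    obtain ⟨e⟩ := extModule_equiv (R := R) i (R ⧸ IsLocalRing.maximalIdeal R)
    exact e.toEquiv.subsingleton_congr.1 this
  letI : Algebra R A := π.toAlgebra
  haveI : IsScalarTower R A M := ⟨fun r a m => by
    rw [Algebra.smul_def, mul_smul]; exact hcompat r _⟩
  haveI : Module.Finite R A := Module.Finite.of_surjective (Algebra.linearMap R A) hπ
  haveI : Module.Finite R M := Module.Finite.trans A M
  have hnt : Nontrivial M := by
    by_contra hc
    rw [not_nontrivial_iff_subsingleton] at hc
    have h1 : Module.support A M = ∅ := Module.support_eq_empty_iff.2 hc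
    rw [moduleDim, h1, Order.krullDim_eq_bot] at hd
    exact absurd hd.symm (WithBot.natCast_ne_bot d)
  -- primes
  let cm : PrimeSpectrum A → PrimeSpectrum R := PrimeSpectrum.comap π
  have hcm : ∀ P r, r ∈ (cm P).asIdeal ↔ π r ∈ P.asIdeal := fun _ _ => Iff.rfl
  have hcmlt : ∀ P Q, P < Q → cm P < cm Q := by
    intro P Q h
    refine lt_of_le_of_ne (Ideal.comap_mono h.le) fun he => h.ne ?_
    exact PrimeSpectrum.comap_injective_of_surjective π hπ he
  have hcms : ∀ P, P ∈ Module.support A M → cm P ∈ Module.support R M := by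
    intro P hP
    by_contra hc
    rw [Module.notMem_support_iff'] at hc
    refine absurd hP ?_
    rw [Module.notMem_support_iff']
    intro m
    obtain ⟨r, hr, h⟩ := hc m
    exact ⟨π r, hr, by rw [hcompat, h]⟩
  have hdq : ∀ P, ringKrullDim (A ⧸ P.asIdeal) = dq (cm P) := by
    intro P
    rw [← ringKrullDim_dq]
    let φ : R →+* A ⧸ P.asIdeal := (Ideal.Quotient.mk P.asIdeal).comp π
    have hφ : Function.Surjective φ := Ideal.Quotient.mk_surjective.comp hπ
    have hk : RingHom.ker φ = (cm P).asIdeal := by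
      ext r
      rw [RingHom.mem_ker, hcm]
      exact Ideal.Quotient.eq_zero_iff_mem
    rw [← hk]
    exact (ringKrullDim_eq_of_ringEquiv (RingHom.quotientKerEquivOfSurjective hφ)).symm
  have hAss : ∀ p : PrimeSpectrum R, p.asIdeal ∈ associatedPrimes R M → dq p = d := by
    intro p hp
    rw [ass_iff0] at hp
    obtain ⟨hp, m, hm⟩ := hp
    let I : Ideal A := Submodule.colon ⊥ {m}
    have hI : ∀ a, a ∈ I ↔ a • m = 0 := by
      intro a
      rw [Submodule.mem_colon_singleton, Submodule.mem_bot]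
    have hIp : ∀ r, π r ∈ I ↔ r ∈ p.asIdeal := by
      intro r
      rw [hI, hm, hcompat]
    have hprime : I.IsPrime := by
      refine ⟨?_, ?_⟩
      · intro h
        apply hp.ne_top
        rw [Ideal.eq_top_iff_one, ← hIp, h]; trivial
      · intro a b hab
        obtain ⟨a, rfl⟩ := hπ a
        obtain ⟨b, rfl⟩ := hπ b
        rw [← map_mul, hIp] at hab
        rw [hIp, hIp]
        exact hp.mem_or_mem hab
    have h1 := hunmixed I ((ass_iff0 _).2 ⟨hprime, m, hI⟩)
    have h2 : cm ⟨I, hprime⟩ = p := by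
      ext r; exact hIp r
    have h3 := hdq ⟨I, hprime⟩
    rw [h2] at h3
    have h4 := h3.symm.trans (h1.trans hd)
    exact (cast_inj' _ _).1 h4
  have hdep : ∀ i, n < i + (d - 1) → VE R i M := by
    obtain ⟨s, hs, rs, h1, h2, h3⟩ := depth_exists (R := A) (X := M) (d-1) hdepth.ge
    choose σ hσ using hπ
    have hmap : (rs.map σ).map (algebraMap R A) = rs := by
      rw [List.map_map]
      conv_rhs => rw [← List.map_id rs]
      congr 1
      funext a
      exact hσ a
    have hmem : ∀ r ∈ rs.map σ, r ∈ IsLocalRing.maximalIdeal R := by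
      intro r hr
      obtain ⟨a, ha, rfl⟩ := List.mem_map.1 hr
      have := h2 a ha
      rw [IsLocalRing.mem_maximalIdeal, mem_nonunits_iff] at this ⊢
      intro hu
      apply this
      rw [← hσ a]
      exact hu.map π
    have hreg : HasReg R s M := by
      refine ⟨rs.map σ, by simpa using h1, hmem, ?_⟩
      rw [IsLocalRing.isRegular_iff_isWeaklyRegular_of_subset_maximalIdeal hmem]
      have h4 := h3.1
      rw [← hmap] at h4
      exact (RingTheory.Sequence.isWeaklyRegular_map_algebraMap_iff A M _).1 h4
    intro i hi
    exact (F3 hG s M).1 hreg i (by omega)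
  refine final hG hAss hdep ?_
  by_contra hc
  push Not at hc
  apply hnotS2
  apply S2crit
  intro P q0 hq0 hlt
  have h1 := supp_le hAss _ (hcms _ hq0)
  have h2 := dq_anti (hcmlt _ _ hlt)
  obtain ⟨x, hx, hr⟩ := exists_reg' hAss (cm P) (by omega)
  refine ⟨π x, hx, ?_, ?_⟩
  · intro a b hab
    apply hr
    simpa [hcompat] using hab
  · intro q q1 hq hlt1 hlt2 hass
    have h3 := supp_le hAss _ (hcms _ hq)
    have h4 := dq_anti (hcmlt _ _ hlt1)
    have h5 := dq_anti (hcmlt _ _ hlt2)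
    refine notass hG hAss hdep (cm P) x hx hr (by omega)
      (fun h6 h7 => hc _ h7 h6) ?_
    rw [ass_iff] at hass ⊢
    obtain ⟨-, m, hm⟩ := hass
    refine ⟨(cm P).2, m, fun r => ?_⟩
    rw [hcm, hm]
    simp only [hcompat]

end helpers

/-- for `M` unmixed of dimension `d`, not `S_2`, with `depth M = d-1`:
`dim D^{d-1}(M) = d-2`, `depth D^{d-1}(M) = depth K_M - 2`, and `D^{d-1}(M)` is
Cohen–Macaulay iff `K_M` is. -/
theorem stmt_6
    (R : Type) [CommRing R] [IsLocalRing R] (hGor : IsGorensteinLocalRing R)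
    (n : ℕ) (hn : ringKrullDim R = n)
    (A : Type) [CommRing A] [IsLocalRing A] [IsNoetherianRing A]
    (π : R →+* A) (hπ : Function.Surjective π)
    (M : Type) [AddCommGroup M] [Module A M] [Module R M] [Module.Finite A M]
    (hcompat : ∀ (r : R) (m : M), π r • m = r • m)
    (d : ℕ) (hd : moduleDim A M = d)
    (hunmixed : IsUnmixed A M) (hnotS2 : ¬ SerreS2 A M)
    (hdepth : moduleDepth A M = (d - 1 : ℕ)) :
    moduleDim R ↥(extModule R (n - (d - 1)) M R) = ((d - 2 : ℕ) : WithBot ℕ∞) ∧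
    moduleDepth R ↥(extModule R (n - (d - 1)) M R) =
      moduleDepth R ↥(extModule R (n - d) M R) - 2 ∧
    (IsCM R ↥(extModule R (n - (d - 1)) M R) ↔ IsCM R ↥(extModule R (n - d) M R)) := by
  obtain ⟨h2, hdn, h⟩ := stmt_aux R hGor n hn A π hπ M hcompat d hd hunmixed hnotS2 hdepth
  rw [show n - (d - 1) = n - d + 1 by omega]
  obtain ⟨e⟩ := extModule_equiv (R := R) (n - d + 1) M
  obtain ⟨e'⟩ := extModule_equiv (R := R) (n - d) M
  rw [dim_congr e, depth_congr e, depth_congr e', CM_congr e, CM_congr e']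
  exact h
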